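/- Let C be a real random variable with Gaussian distribution N(μ, σ²) where σ > 0, and define the constraint violation C⁺ = max(−C, 0). Then the second moment satisfies E[(C⁺)²] = (μ² + σ²)·Φ(z) − μ·σ·φ(z), where z = −μ/σ. -/

import Mathlib

open MeasureTheory ProbabilityTheory Real

/-- The standard normal probability density function φ(s) = (2π)^{-1/2} exp(−s²/2). -/
noncomputable def stdNormalPDF (s : ℝ) : ℝ :=
  (Real.sqrt (2 * Real.pi))⁻¹ * Real.exp (-(s ^ 2) / 2)

/-- The standard normal cumulative distribution function Φ(t) = ∫_{−∞}^{t} φ(s) ds. -/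
noncomputable def stdNormalCDF (t : ℝ) : ℝ :=
  ∫ s in Set.Iic t, stdNormalPDF s

lemma stdNormalPDF_eq_gaussianPDFReal (s : ℝ) : stdNormalPDF s = gaussianPDFReal 0 1 s := by
  simp [stdNormalPDF, gaussianPDFReal]

lemma hasDerivAt_stdNormalPDF (s : ℝ) : HasDerivAt stdNormalPDF (-s * stdNormalPDF s) s := by
  have h : HasDerivAt (fun s : ℝ ↦ -(s ^ 2) / 2) (-s) s := by
    refine ((hasDerivAt_pow 2 s).neg.div_const 2).congr_deriv ?_
    norm_num
    ring
  refine (h.exp.const_mul (Real.sqrt (2 * Real.pi))⁻¹).congr_deriv ?_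
  rw [stdNormalPDF]
  ring

lemma integrable_pow_mul_stdNormalPDF (k : ℕ) :
    Integrable (fun s : ℝ ↦ s ^ k * stdNormalPDF s) := by
  have h := integrable_rpow_mul_exp_neg_mul_sq (b := 1 / 2) (by norm_num) (s := k)
    (by linarith [k.cast_nonneg (α := ℝ)])
  convert h.const_mul (Real.sqrt (2 * Real.pi))⁻¹ using 2 with s
  rw [Real.rpow_natCast, stdNormalPDF, show -(s ^ 2) / 2 = -(1 / 2) * s ^ 2 by ring]
  ring

lemma integral_Iic_sub_sq_mul_stdNormalPDF (z : ℝ) :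
    ∫ s in Set.Iic z, (z - s) ^ 2 * stdNormalPDF s
      = (z ^ 2 + 1) * stdNormalCDF z + z * stdNormalPDF z := by
  have h0 : Integrable stdNormalPDF := by simpa using integrable_pow_mul_stdNormalPDF 0
  have h1 : Integrable (fun s : ℝ ↦ s * stdNormalPDF s) := by
    simpa using integrable_pow_mul_stdNormalPDF 1
  have h2 := integrable_pow_mul_stdNormalPDF 2
  have hF : Integrable (fun s ↦ (2 * z - s) * stdNormalPDF s) := by
    convert (h0.const_mul (2 * z)).sub h1 using 2 with s
    simp only [Pi.sub_apply]
    ring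
  have hF' : Integrable (fun s ↦ (s ^ 2 - 2 * z * s - 1) * stdNormalPDF s) := by
    convert (h2.sub (h1.const_mul (2 * z))).sub h0 using 2 with s
    simp only [Pi.sub_apply]
    ring
  have hd (s : ℝ) : HasDerivAt (fun s ↦ (2 * z - s) * stdNormalPDF s)
      ((s ^ 2 - 2 * z * s - 1) * stdNormalPDF s) s := by
    refine (((hasDerivAt_id' s).const_sub (2 * z)).mul (hasDerivAt_stdNormalPDF s)).congr_deriv ?_
    ring
  have hlim := tendsto_zero_of_hasDerivAt_of_integrableOn_Iic (a := z) (fun s _ ↦ hd s)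
    hF'.integrableOn hF.integrableOn
  have hint := integral_Iic_of_hasDerivAt_of_tendsto' (a := z) (fun s _ ↦ hd s)
    hF'.integrableOn hlim
  calc ∫ s in Set.Iic z, (z - s) ^ 2 * stdNormalPDF s
      = ∫ s in Set.Iic z, ((z ^ 2 + 1) * stdNormalPDF s
          + (s ^ 2 - 2 * z * s - 1) * stdNormalPDF s) := by
        congr 1 with s
        ring
    _ = (z ^ 2 + 1) * stdNormalCDF z + z * stdNormalPDF z := by
        rw [integral_add (h0.const_mul _).integrableOn hF'.integrableOn, integral_const_mul, hint,
          stdNormalCDF]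
        ring

lemma gaussianReal_eq_map_standard (μ σ : ℝ) :
    gaussianReal μ ⟨σ ^ 2, sq_nonneg σ⟩
      = (gaussianReal 0 1).map (fun s ↦ σ * s + μ) := by
  rw [show (fun s : ℝ ↦ σ * s + μ) = (fun x ↦ x + μ) ∘ (fun s ↦ σ * s) from rfl,
    ← Measure.map_map (by fun_prop) (by fun_prop), gaussianReal_map_const_mul,
    gaussianReal_map_add_const]
  simp only [mul_zero, zero_add, mul_one]
  rfl

/-- If C ~ N(μ, σ²) with σ > 0 and C⁺ = max(−C, 0), then
E[(C⁺)²] = (μ² + σ²)·Φ(z) − μ·σ·φ(z) with z = −μ/σ. -/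
theorem second_moment_constraint_violation_gaussian {Ω : Type*} [MeasurableSpace Ω]
    (P : Measure Ω) [IsProbabilityMeasure P]
    (C : Ω → ℝ) (hC : Measurable C) (μ σ : ℝ) (hσ : 0 < σ)
    (hdist : P.map C = gaussianReal μ ⟨σ ^ 2, sq_nonneg σ⟩) :
    (∫ ω, (max (-(C ω)) 0) ^ 2 ∂P)
      = (μ ^ 2 + σ ^ 2) * stdNormalCDF (-μ / σ) - μ * σ * stdNormalPDF (-μ / σ) := by
  have hmax (s : ℝ) : stdNormalPDF s * (max (-(σ * s + μ)) 0) ^ 2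
      = (Set.Iic (-μ / σ)).indicator
          (fun s ↦ σ ^ 2 * ((-μ / σ - s) ^ 2 * stdNormalPDF s)) s := by
    have hz : -(σ * s + μ) = σ * (-μ / σ - s) := by
      field_simp
      ring
    by_cases hs : s ≤ -μ / σ
    · rw [Set.indicator_of_mem (Set.mem_Iic.mpr hs), hz,
        max_eq_left (mul_nonneg hσ.le (sub_nonneg.mpr hs))]
      ring
    · rw [Set.indicator_of_notMem (by simpa using hs), hz, max_eq_right
        (mul_nonpos_of_nonneg_of_nonpos hσ.le (by linarith))]
      ring
  calc ∫ ω, (max (-(C ω)) 0) ^ 2 ∂P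
      = ∫ x, (max (-x) 0) ^ 2 ∂(P.map C) :=
        (integral_map (f := fun x : ℝ ↦ (max (-x) 0) ^ 2) hC.aemeasurable
          (by fun_prop)).symm
    _ = ∫ s, (max (-(σ * s + μ)) 0) ^ 2 ∂(gaussianReal 0 1) := by
        rw [hdist, gaussianReal_eq_map_standard, integral_map (by fun_prop) (by fun_prop)]
    _ = ∫ s in Set.Iic (-μ / σ), σ ^ 2 * ((-μ / σ - s) ^ 2 * stdNormalPDF s) := by
        rw [integral_gaussianReal_eq_integral_smul one_ne_zero,
          ← integral_indicator measurableSet_Iic]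
        simp only [smul_eq_mul, ← stdNormalPDF_eq_gaussianPDFReal, hmax]
    _ = (μ ^ 2 + σ ^ 2) * stdNormalCDF (-μ / σ) - μ * σ * stdNormalPDF (-μ / σ) := by
        rw [integral_const_mul, integral_Iic_sub_sq_mul_stdNormalPDF]
        field_simp
        ring
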